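/- Let A be an essentially small hereditary abelian category, linear over a finite field F_q, with finite-dimensional Hom and Ext spaces. For any object A of A (viewed as a stalk complex), the number of automorphisms of A in the 1-periodic derived category D₁(A) equals |Aut_A(A)| · |Ext¹_A(A,A)|. -/

import Mathlib

/-!
Formalization of statements from "ıquantum groups of split type via derived Hall algebras"
(Chen–Lu–Ruan).  We set up 1-periodic complexes, the 1-periodic derived category,
derived Hall algebras and ıHall algebras.
-/

open CategoryTheory Limits

noncomputable section

universe w w' w'' v u

/-- The type of isomorphism classes of objects of a category. -/
abbrev IsoCls (C : Type u) [Category.{v} C] : Type u :=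
  Quotient (CategoryTheory.isIsomorphicSetoid C)

/-- The isomorphism class `[X]` of an object `X`. -/
abbrev mkIso {C : Type u} [Category.{v} C] (X : C) : IsoCls C :=
  Quotient.mk (CategoryTheory.isIsomorphicSetoid C) X

/-- The complex shape whose homological complexes are the `1`-periodic complexes
`(X, d)` with `d : X ⟶ X`, `d ∘ d = 0`. -/
def oneShape : ComplexShape Unit where
  Rel _ _ := True
  next_eq _ _ := rfl
  prev_eq _ _ := rfl

/-- The category `C₁(A)` of `1`-periodic complexes over `A`. -/
abbrev OnePeriodic (A : Type u) [Category.{v} A] [Abelian A] := HomologicalComplex A oneShape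

section OnePeriodicDefs

variable {A : Type u} [Category.{v} A] [Abelian A]

/-- The stalk complex `C_X = (X, 0)`. -/
def stalkC (X : A) : OnePeriodic A where
  X _ := X
  d _ _ := 0
  shape _ _ h := absurd trivial h
  d_comp_d' := by intros; simp

/-- The morphism of stalk complexes induced by a morphism of `A`. -/
def stalkHom {X Y : A} (f : X ⟶ Y) : stalkC X ⟶ stalkC Y where
  f _ := f
  comm' := by intros; simp [stalkC]

/-- The acyclic complex `K_X = (X ⊕ X, (0 1 // 0 0))`. -/
def KC (X : A) : OnePeriodic A where
  X _ := X ⊞ X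
  d _ _ := biprod.snd ≫ biprod.inl
  shape _ _ h := absurd trivial h
  d_comp_d' := by intros; simp

/-- A `1`-periodic complex is acyclic if `ker d = Im d`, i.e. if it is exact. -/
def IsAcyclic (K : OnePeriodic A) : Prop := ∀ i, K.ExactAt i

/-- The cohomology `H(X•) = ker d / Im d` of a `1`-periodic complex. -/
abbrev cohomology (M : OnePeriodic A) : A := M.homology ()

/-- The underlying object `res(M•)` of a `1`-periodic complex (restriction functor,
forgetting the differential). -/
abbrev resOP (M : OnePeriodic A) : A := M.X ()

/-- The image `Im d` of the differential of a `1`-periodic complex. -/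
def imd (M : OnePeriodic A) : A := Limits.image (M.d () ())

/-- The mapping cone of a morphism of `1`-periodic complexes:
`Y ⊕ X` with differential `(d_Y g // 0 -d_X)`. -/
def cone1 {X Y : OnePeriodic A} (g : X ⟶ Y) : OnePeriodic A where
  X _ := Y.X () ⊞ X.X ()
  d _ _ := biprod.desc (Y.d () () ≫ biprod.inl) (g.f () ≫ biprod.inl - X.d () () ≫ biprod.inr)
  shape _ _ h := absurd trivial h
  d_comp_d' := by
    intros
    apply biprod.hom_ext'
    · rw [biprod.inl_desc_assoc, Category.assoc, biprod.inl_desc, ← Category.assoc,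
        HomologicalComplex.d_comp_d, zero_comp, comp_zero]
    · rw [biprod.inr_desc_assoc, Preadditive.sub_comp, Category.assoc, Category.assoc,
        biprod.inl_desc, biprod.inr_desc, comp_zero, ← Category.assoc,
        HomologicalComplex.Hom.comm, Category.assoc, Preadditive.comp_sub, ← Category.assoc,
        ← Category.assoc, HomologicalComplex.d_comp_d, zero_comp, sub_zero, sub_self]

end OnePeriodicDefs

section Counting

variable {A : Type u} [Category.{v} A] [Abelian A]

/-- `a_X`, the number of automorphisms of `X`. -/
def autCard (X : A) : ℕ := Nat.card (Aut X)

/-- The number of morphisms `X ⟶ Y`. -/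
def homCard (X Y : A) : ℕ := Nat.card (X ⟶ Y)

/-- The Hall number `F_{MN}^L`: the number of subobjects `X ⊆ L` with `X ≅ N`
and `L/X ≅ M`. -/
def FHall (M N L : A) : ℕ :=
  Nat.card {X : Subobject L // Nonempty ((X : A) ≅ N) ∧ Nonempty ((cokernel X.arrow) ≅ M)}

/-- The number of short exact sequences `0 → N → L → M → 0` with fixed end terms and
middle term.  By the Riedtmann–Peng formula, `|Ext¹(M,N)_L| / |Hom(M,N)|` equals
`sesCount M N L / a_L`. -/
def sesCount (M N L : A) : ℕ :=
  Nat.card {p : (N ⟶ L) × (L ⟶ M) // ∃ w : p.1 ≫ p.2 = 0, (ShortComplex.mk p.1 p.2 w).ShortExact}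

end Counting

/-- `v = √q`, where `q` is the cardinality of the finite base field. -/
def vSq (k : Type) [Fintype k] : ℝ := Real.sqrt (Fintype.card k)

section EulerForm

variable {A : Type u} [Category.{v} A] [Abelian A] [HasExt.{w} A]

/-- The number of elements of `Ext¹(X, Y)`. -/
def ext1Card (X Y : A) : ℕ := Nat.card (Abelian.Ext X Y 1)

/-- The Euler form `⟨X,Y⟩ = dim_k Hom(X,Y) - dim_k Ext¹(X,Y)`; the dimensions of these
finite dimensional `k`-vector spaces are read off from their cardinalities. -/
def eulerF (k : Type) [Fintype k] (X Y : A) : ℤ :=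
  (Nat.log (Fintype.card k) (homCard X Y) : ℤ) - (Nat.log (Fintype.card k) (ext1Card X Y) : ℤ)

end EulerForm

section DerivedCategoryOne

variable {A : Type u} [Category.{v} A] [Abelian A]
  [MorphismProperty.HasLocalization.{w'} (HomologicalComplex.quasiIso A oneShape)]

/-- The `1`-periodic derived category `D₁(A)`: the localization of (the homotopy category of)
`C₁(A)` at the quasi-isomorphisms. -/
abbrev DOne (A : Type u) [Category.{v} A] [Abelian A]
    [MorphismProperty.HasLocalization.{w'} (HomologicalComplex.quasiIso A oneShape)] :=
  HomologicalComplexUpToQuasiIso A oneShape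

/-- The localization functor `C₁(A) ⥤ D₁(A)`. -/
abbrev QD : OnePeriodic A ⥤ DOne A := HomologicalComplexUpToQuasiIso.Q

/-- The number of morphisms `A ⟶ B` in `D₁(A)` (for stalk complexes). -/
def homD1Card (X Y : A) : ℕ := Nat.card (QD.obj (stalkC X) ⟶ QD.obj (stalkC Y))

/-- `ã_X`, the number of automorphisms of `X` in `D₁(A)`. -/
def autD1 (X : A) : ℕ := Nat.card (Aut (QD.obj (stalkC X)))

/-- `{X,Y} = 1 / |Hom_{D₁(A)}(X,Y)|`. -/
def braceD (X Y : A) : ℝ := ((homD1Card X Y : ℝ))⁻¹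

/-- `M` is a cone of the morphism `f : X ⟶ Y` of `D₁(A)`: writing `f` as a right fraction
`Q(s)⁻¹ ≫ Q(g)` with `s` a quasi-isomorphism of `1`-periodic complexes, the mapping cone of
`g` is isomorphic to `M` in `D₁(A)`. -/
def IsConeOf {X Y : A} (f : QD.obj (stalkC X) ⟶ QD.obj (stalkC Y)) (M : A) : Prop :=
  ∃ (Z : OnePeriodic A) (s : Z ⟶ stalkC X) (g : Z ⟶ stalkC Y),
    HomologicalComplex.quasiIso A oneShape s ∧ QD.map s ≫ f = QD.map g ∧
      Nonempty (QD.obj (cone1 g) ≅ QD.obj (stalkC M))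

/-- `|(X,Y)_M|`, the number of morphisms `f ∈ Hom_{D₁(A)}(X,Y)` with cone isomorphic
to `M`. -/
def coneCount (X Y M : A) : ℕ :=
  Nat.card {f : QD.obj (stalkC X) ⟶ QD.obj (stalkC Y) // IsConeOf f M}

/-- The derived Hall number `G_{XY}^M`, given by the derived Riedtmann–Peng formula
`G_{XY}^M = (ã_M |(X,Y)_M| / (ã_X ã_Y)) √({X,Y}{M,M}/({X,X}{Y,Y}))`. -/
def Gnum (X Y M : A) : ℝ :=
  ((autD1 M : ℝ) * (coneCount X Y M : ℝ)) / ((autD1 X : ℝ) * (autD1 Y : ℝ)) *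
    Real.sqrt ((braceD X Y * braceD M M) / (braceD X X * braceD Y Y))

end DerivedCategoryOne

section Efface

variable {A : Type u} [Category.{v} A] [Abelian A]

open DerivedCategory in
/-- A morphism in the derived category from an object in degree `i` to a bounded above complex
living in degrees `< i` is killed by an epimorphism onto this object. -/
lemma exists_epi_Q_map_comp_eq_zero [HasDerivedCategory.{w''} A] {X : A} {i : ℤ}
    {L : CochainComplex A ℤ}
    (φ : Q.obj ((CochainComplex.singleFunctor A i).obj X) ⟶ Q.obj L)
    (n : ℤ) (hn : n < i) [L.IsStrictlyLE n] :
    ∃ (E : A) (p : E ⟶ X), Epi p ∧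
      Q.map ((CochainComplex.singleFunctor A i).map p) ≫ φ = 0 := by
  obtain ⟨K, _, s, h, g, rfl⟩ := right_fac_of_isStrictlyLE φ i
  have hs : QuasiIso s := by rwa [isIso_Q_map_iff_quasiIso] at h
  let e : ((CochainComplex.singleFunctor A i).obj X).X i ≅ X :=
    HomologicalComplex.singleObjXSelf (ComplexShape.up ℤ) i X
  let ι : (CochainComplex.singleFunctor A i).obj (K.X i) ⟶ K :=
    HomologicalComplex.mkHomFromSingle (𝟙 _) (by
      rintro j hj
      apply (K.isZero_of_isStrictlyLE i j (by simp at hj; omega)).eq_of_tgt)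
  let p : K.X i ⟶ X := s.f i ≫ e.hom
  have hp : Epi (s.f i) := by
    have h1 : Epi (HomologicalComplex.homologyMap s i) := inferInstance
    rw [HomologicalComplex.epi_homologyMap_iff_up_to_refinements s (i - 1) i (i + 1)
      (by simp) (by simp)] at h1
    rw [epi_iff_surjective_up_to_refinements]
    intro T y
    obtain ⟨T', π, hπ, x, hx, y₁, fac⟩ := h1 y (by
      apply (HomologicalComplex.isZero_single_obj_X (ComplexShape.up ℤ) i X (i + 1)
        (by simp)).eq_of_tgt)
    refine ⟨T', π, hπ, x, ?_⟩
    have hy₁ : y₁ = 0 := (HomologicalComplex.isZero_single_obj_X (ComplexShape.up ℤ) i X (i - 1)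
      (by simp)).eq_of_tgt y₁ 0
    rw [fac, hy₁, zero_comp, add_zero]
  have h₁ : ι ≫ s = (CochainComplex.singleFunctor A i).map p := by
    apply HomologicalComplex.from_single_hom_ext
    refine (congrArg (· ≫ s.f i) (HomologicalComplex.mkHomFromSingle_f _ _)).trans
      (.trans ?_ (HomologicalComplex.single_map_f_self (c := .up ℤ) i p).symm)
    change (_ ≫ 𝟙 _) ≫ s.f i = _ ≫ (s.f i ≫ e.hom) ≫ e.inv
    rw [Category.comp_id, Category.assoc, e.hom_inv_id, Category.comp_id]
  have h₂ : ι ≫ g = 0 := by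
    apply HomologicalComplex.from_single_hom_ext
    apply (L.isZero_of_isStrictlyLE n i hn).eq_of_tgt
  refine ⟨K.X i, p, epi_comp _ _, ?_⟩
  rw [← h₁, Q.map_comp, Category.assoc, IsIso.hom_inv_id_assoc, ← Q.map_comp, h₂, Q.map_zero]

open DerivedCategory in
/-- Positive degree `Ext` classes are effaceable. -/
lemma CategoryTheory.Abelian.Ext.exists_epi_mk₀_comp_eq_zero [HasExt.{w} A] {X Y : A} {n : ℕ}
    (e : Abelian.Ext X Y (n + 1)) :
    ∃ (E : A) (p : E ⟶ X), Epi p ∧ (Abelian.Ext.mk₀ p).comp e (zero_add _) = 0 := by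
  let := HasDerivedCategory.standard A
  obtain ⟨E, p, hp, h⟩ := exists_epi_Q_map_comp_eq_zero
    (L := (CochainComplex.singleFunctor A (-(n + 1))).obj Y) (i := 0)
    (e.hom ≫ ((singleFunctors A).shiftIso (n + 1) (-(n + 1)) 0 (by lia)).hom.app Y)
    (-(n + 1)) (by lia)
  refine ⟨E, p, hp, ?_⟩
  apply Abelian.Ext.homEquiv.injective
  change ((Abelian.Ext.mk₀ p).comp e (zero_add _)).hom = Abelian.Ext.hom 0
  rw [← cancel_mono (((singleFunctors A).shiftIso (n + 1) (-(n + 1)) 0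
    (by lia)).hom.app _), Abelian.Ext.zero_hom, Limits.zero_comp, Abelian.Ext.comp_hom,
    Abelian.Ext.mk₀_hom, ShiftedHom.mk₀_comp, Category.assoc]
  exact h

end Efface

section Resolution
variable {A : Type u} [Category.{v} A] [Abelian A]

lemma kernel_shortExact {E X : A} (p : E ⟶ X) [Epi p] :
    (ShortComplex.mk (kernel.ι p) p (kernel.condition p)).ShortExact :=
  { exact := ShortComplex.exact_of_f_is_kernel _ (kernelIsKernel p) }

/-- In a hereditary category, a morphism out of the kernel of an epimorphism `p : E ⟶ X`
can be lifted along any epimorphism after refining `E`. -/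
lemma exists_refinement_lift [HasExt.{w} A]
    (hH : ∀ X Y : A, Subsingleton (Abelian.Ext X Y 2))
    {E X M N : A} (p : E ⟶ X) [Epi p] (q : M ⟶ N) [Epi q] (f : kernel p ⟶ N) :
    ∃ (E' : A) (r : E' ⟶ E) (_ : Epi r) (l : kernel (r ≫ p) ⟶ M),
      l ≫ q = kernel.lift p (kernel.ι (r ≫ p) ≫ r) (by simp) ≫ f := by
  have hq := kernel_shortExact q
  obtain ⟨c, hc⟩ := Abelian.Ext.contravariant_sequence_exact₁ (kernel_shortExact p) (kernel q)
    ((Abelian.Ext.mk₀ f).comp hq.extClass (zero_add 1)) (n₁ := 2) rfl (Subsingleton.elim _ _)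
  obtain ⟨E', r, hr, h⟩ := c.exists_epi_mk₀_comp_eq_zero
  refine ⟨E', r, hr, ?_⟩
  let k := kernel.lift p (kernel.ι (r ≫ p) ≫ r) (by simp)
  obtain ⟨l, hl⟩ := Abelian.Ext.covariant_sequence_exact₃ _ hq (Abelian.Ext.mk₀ (k ≫ f))
    (zero_add 1) (by
      rw [← Abelian.Ext.mk₀_comp_mk₀, Abelian.Ext.comp_assoc_of_second_deg_zero, ← hc]
      dsimp only
      rw [Abelian.Ext.mk₀_comp_mk₀_assoc, kernel.lift_ι, ← Abelian.Ext.mk₀_comp_mk₀_assoc, h,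
        Abelian.Ext.comp_zero])
  obtain ⟨l, rfl⟩ := Abelian.Ext.mk₀_bijective _ _ |>.2 l
  exact ⟨l, (Abelian.Ext.mk₀_bijective _ _).1 (by simpa using hl)⟩

end Resolution

section Covers

variable {A : Type u} [Category.{v} A] [Abelian A]

/-- An object `E` with an epimorphism onto `X`, regarded as the resolution
`0 → K → E → X → 0` of `X` of length one. -/
structure Cover (X : A) where
  /-- the covering object -/
  E : A
  /-- the covering morphism -/
  p : E ⟶ X
  epi : Epi p

namespace Cover

variable {X : A}

instance (C : Cover X) : Epi C.p := C.epi

/-- The kernel of a cover. -/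
abbrev K (C : Cover X) : A := kernel C.p

/-- The inclusion of the kernel of a cover. -/
abbrev i (C : Cover X) : C.K ⟶ C.E := kernel.ι C.p

/-- Morphisms of covers, i.e. morphisms over `X`. -/
structure Hom (C' C : Cover X) where
  /-- the morphism between the covering objects -/
  r : C'.E ⟶ C.E
  w : r ≫ C.p = C'.p

attribute [simp] Hom.w

namespace Hom

/-- The morphism induced on kernels. -/
def k {C' C : Cover X} (r : Hom C' C) : C'.K ⟶ C.K :=
  kernel.lift C.p (C'.i ≫ r.r) (by simp)

@[simp]
lemma k_i {C' C : Cover X} (r : Hom C' C) : r.k ≫ C.i = C'.i ≫ r.r :=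
  kernel.lift_ι _ _ _

@[simp]
lemma k_i_assoc {C' C : Cover X} (r : Hom C' C) {T : A} (f : C.E ⟶ T) :
    r.k ≫ C.i ≫ f = C'.i ≫ r.r ≫ f := by
  rw [← Category.assoc, k_i, Category.assoc]

/-- The composition of morphisms of covers. -/
@[simps]
def comp {C'' C' C : Cover X} (r' : Hom C'' C') (r : Hom C' C) : Hom C'' C where
  r := r'.r ≫ r.r
  w := by simp

@[simp]
lemma comp_k {C'' C' C : Cover X} (r' : Hom C'' C') (r : Hom C' C) :
    (r'.comp r).k = r'.k ≫ r.k := by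
  simp [← cancel_mono C.i]

/-- The identity morphism of a cover. -/
@[simps]
def id (C : Cover X) : Hom C C where
  r := 𝟙 _
  w := by simp

@[simp]
lemma id_k (C : Cover X) : (id C).k = 𝟙 _ := by
  simp [← cancel_mono C.i]

end Hom

/-- The identity cover. -/
@[simps]
def refl (X : A) : Cover X where
  E := X
  p := 𝟙 X
  epi := inferInstance

/-- The morphism from any cover to the identity cover. -/
@[simps]
def toRefl (C : Cover X) : Hom C (refl X) where
  r := C.p
  w := Category.comp_id _

/-- Any two covers have a common refinement. -/
lemma exists_common (C₁ C₂ : Cover X) :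
    ∃ (C : Cover X) (_ : Hom C C₁) (_ : Hom C C₂), True :=
  ⟨⟨pullback C₁.p C₂.p, pullback.fst _ _ ≫ C₁.p, epi_comp _ _⟩,
    ⟨pullback.fst _ _, rfl⟩, ⟨pullback.snd _ _, pullback.condition.symm⟩, trivial⟩

/-- In a hereditary category, a cover can be refined along an epimorphism onto its kernel. -/
lemma exists_refinement_kernel [HasExt.{w} A]
    (hH : ∀ X Y : A, Subsingleton (Abelian.Ext X Y 2))
    (C : Cover X) {T : A} (t : T ⟶ C.K) [Epi t] :
    ∃ (C' : Cover X) (r : Hom C' C) (l : C'.K ⟶ T), l ≫ t = r.k := by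
  obtain ⟨E', r, hr, l, hl⟩ := exists_refinement_lift hH C.p t (𝟙 _)
  exact ⟨⟨E', r ≫ C.p, epi_comp _ _⟩, ⟨r, rfl⟩, l, by rw [hl, Category.comp_id]; rfl⟩

/-- A morphism of complexes from the resolution `K → E` to the `1`-periodic complex `Z`. -/
@[ext]
structure Map (C : Cover X) (Z : OnePeriodic A) where
  /-- the component on the covering object -/
  b : C.E ⟶ Z.X ()
  /-- the component on the kernel -/
  a : C.K ⟶ Z.X ()
  b_d : b ≫ Z.d () () = 0
  a_d : a ≫ Z.d () () = C.i ≫ b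

attribute [simp] Map.b_d Map.a_d

namespace Map

variable {Z Z' : OnePeriodic A}

@[simp]
lemma b_d_assoc {C : Cover X} (φ : C.Map Z) {T : A} (f : Z.X () ⟶ T) :
    φ.b ≫ Z.d () () ≫ f = 0 := by
  rw [← Category.assoc, φ.b_d, zero_comp]

@[simp]
lemma a_d_assoc {C : Cover X} (φ : C.Map Z) {T : A} (f : Z.X () ⟶ T) :
    φ.a ≫ Z.d () () ≫ f = C.i ≫ φ.b ≫ f := by
  rw [← Category.assoc, φ.a_d, Category.assoc]

/-- Restriction along a morphism of covers. -/
@[simps]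
def refine {C C' : Cover X} (φ : C.Map Z) (r : Hom C' C) : C'.Map Z where
  b := r.r ≫ φ.b
  a := r.k ≫ φ.a
  b_d := by simp
  a_d := by simp

/-- Composition with a morphism of `1`-periodic complexes. -/
@[simps]
def post {C : Cover X} (φ : C.Map Z) (s : Z ⟶ Z') : C.Map Z' where
  b := φ.b ≫ s.f ()
  a := φ.a ≫ s.f ()
  b_d := by simp
  a_d := by simp

/-- The homotopy relation. -/
def Htpy {C : Cover X} (φ φ' : C.Map Z) : Prop :=
  ∃ (h : C.E ⟶ Z.X ()) (g : C.K ⟶ Z.X ()),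
    φ.b = φ'.b + h ≫ Z.d () () ∧ φ.a = φ'.a + C.i ≫ h + g ≫ Z.d () ()

lemma Htpy.refl {C : Cover X} (φ : C.Map Z) : Htpy φ φ := ⟨0, 0, by simp, by simp⟩

lemma Htpy.symm {C : Cover X} {φ φ' : C.Map Z} (H : Htpy φ φ') : Htpy φ' φ := by
  obtain ⟨h, g, hb, ha⟩ := H
  refine ⟨-h, -g, ?_, ?_⟩
  · simp [hb]
  · simp only [ha, Preadditive.comp_neg, Preadditive.neg_comp]; abel

lemma Htpy.trans {C : Cover X} {φ φ' φ'' : C.Map Z} (H : Htpy φ φ') (H' : Htpy φ' φ'') :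
    Htpy φ φ'' := by
  obtain ⟨h, g, hb, ha⟩ := H
  obtain ⟨h', g', hb', ha'⟩ := H'
  refine ⟨h + h', g + g', ?_, ?_⟩
  · simp only [hb, hb', Preadditive.add_comp]; abel
  · simp only [ha, ha', Preadditive.add_comp, Preadditive.comp_add]; abel

lemma Htpy.refine {C C' : Cover X} {φ φ' : C.Map Z} (H : Htpy φ φ') (r : Hom C' C) :
    Htpy (φ.refine r) (φ'.refine r) := by
  obtain ⟨h, g, hb, ha⟩ := H
  exact ⟨r.r ≫ h, r.k ≫ g, by simp [hb], by simp [ha]⟩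

lemma Htpy.post {C : Cover X} {φ φ' : C.Map Z} (H : Htpy φ φ') (s : Z ⟶ Z') :
    Htpy (φ.post s) (φ'.post s) := by
  obtain ⟨h, g, hb, ha⟩ := H
  exact ⟨h ≫ s.f (), g ≫ s.f (), by simp [hb], by simp [ha]⟩

/-- Restrictions along two morphisms of covers are homotopic. -/
lemma htpy_refine {C C' : Cover X} (φ : C.Map Z) (r r' : Hom C' C) :
    Htpy (φ.refine r) (φ.refine r') := by
  let h : C'.E ⟶ C.K := kernel.lift C.p (r.r - r'.r) (by simp)
  have hi : h ≫ C.i = r.r - r'.r := kernel.lift_ι _ _ _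
  have hk : C'.i ≫ h = r.k - r'.k := by
    rw [← cancel_mono C.i]
    simp [hi]
  refine ⟨h ≫ φ.a, 0, ?_, ?_⟩
  · simp [← Category.assoc h, hi]
  · simp [← Category.assoc _ h, hk]

@[simp]
lemma refine_refine {C C' C'' : Cover X} (φ : C.Map Z) (r : Hom C' C) (r' : Hom C'' C') :
    (φ.refine r).refine r' = φ.refine (r'.comp r) := by
  ext <;> simp

lemma refine_post {C C' : Cover X} (φ : C.Map Z) (r : Hom C' C) (s : Z ⟶ Z') :
    (φ.refine r).post s = (φ.post s).refine r := by
  ext <;> simp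

end Map

lemma exists_lift_cycle {Z' Z : OnePeriodic A} (s : Z' ⟶ Z) [QuasiIso s] {T : A}
    (y : T ⟶ Z.X ()) (hy : y ≫ Z.d () () = 0) :
    ∃ (T' : A) (π : T' ⟶ T) (_ : Epi π) (x : T' ⟶ Z'.X ()) (_ : x ≫ Z'.d () () = 0)
      (h : T' ⟶ Z.X ()), π ≫ y = x ≫ s.f () + h ≫ Z.d () () :=
  (HomologicalComplex.epi_homologyMap_iff_up_to_refinements s () () () rfl rfl).1
    inferInstance y hy

lemma exists_lift_boundary {Z' Z : OnePeriodic A} (s : Z' ⟶ Z) [QuasiIso s] {T : A}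
    (x : T ⟶ Z'.X ()) (hx : x ≫ Z'.d () () = 0) (h : T ⟶ Z.X ())
    (hh : x ≫ s.f () = h ≫ Z.d () ()) :
    ∃ (T' : A) (π : T' ⟶ T) (_ : Epi π) (x₁ : T' ⟶ Z'.X ()), π ≫ x = x₁ ≫ Z'.d () () :=
  (HomologicalComplex.mono_homologyMap_iff_up_to_refinements s () () () rfl rfl).1
    inferInstance x hx h hh

section QuasiIso

variable {Z' Z : OnePeriodic A} (s : Z' ⟶ Z) [QuasiIso s]

lemma exists_lift_cycle_cover (C : Cover X) (y : C.E ⟶ Z.X ()) (hy : y ≫ Z.d () () = 0) :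
    ∃ (C' : Cover X) (r : Hom C' C) (x : C'.E ⟶ Z'.X ()) (_ : x ≫ Z'.d () () = 0)
      (h : C'.E ⟶ Z.X ()), r.r ≫ y = x ≫ s.f () + h ≫ Z.d () () := by
  obtain ⟨T, t, _, x, hx, h, e⟩ := exists_lift_cycle s y hy
  exact ⟨⟨T, t ≫ C.p, epi_comp _ _⟩, ⟨t, rfl⟩, x, hx, h, e⟩

lemma exists_lift_boundary_cover (C : Cover X) (x : C.E ⟶ Z'.X ()) (hx : x ≫ Z'.d () () = 0)
    (h : C.E ⟶ Z.X ()) (hh : x ≫ s.f () = h ≫ Z.d () ()) :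
    ∃ (C' : Cover X) (r : Hom C' C) (x₁ : C'.E ⟶ Z'.X ()), r.r ≫ x = x₁ ≫ Z'.d () () := by
  obtain ⟨T, t, _, x₁, e⟩ := exists_lift_boundary s x hx h hh
  exact ⟨⟨T, t ≫ C.p, epi_comp _ _⟩, ⟨t, rfl⟩, x₁, e⟩

variable [HasExt.{w} A]

lemma exists_lift_cycle_kernel (hH : ∀ X Y : A, Subsingleton (Abelian.Ext X Y 2))
    (C : Cover X) (y : C.K ⟶ Z.X ()) (hy : y ≫ Z.d () () = 0) :
    ∃ (C' : Cover X) (r : Hom C' C) (x : C'.K ⟶ Z'.X ()) (_ : x ≫ Z'.d () () = 0)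
      (h : C'.K ⟶ Z.X ()), r.k ≫ y = x ≫ s.f () + h ≫ Z.d () () := by
  obtain ⟨T, t, _, x, hx, h, e⟩ := exists_lift_cycle s y hy
  obtain ⟨C', r, l, hl⟩ := C.exists_refinement_kernel hH t
  exact ⟨C', r, l ≫ x, by simp [hx], l ≫ h, by
    rw [← hl, Category.assoc, e, Preadditive.comp_add, Category.assoc, Category.assoc]⟩

lemma exists_lift_boundary_kernel (hH : ∀ X Y : A, Subsingleton (Abelian.Ext X Y 2))
    (C : Cover X) (x : C.K ⟶ Z'.X ()) (hx : x ≫ Z'.d () () = 0)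
    (h : C.K ⟶ Z.X ()) (hh : x ≫ s.f () = h ≫ Z.d () ()) :
    ∃ (C' : Cover X) (r : Hom C' C) (x₁ : C'.K ⟶ Z'.X ()), r.k ≫ x = x₁ ≫ Z'.d () () := by
  obtain ⟨T, t, _, x₁, e⟩ := exists_lift_boundary s x hx h hh
  obtain ⟨C', r, l, hl⟩ := C.exists_refinement_kernel hH t
  exact ⟨C', r, l ≫ x₁, by rw [← hl, Category.assoc, e, Category.assoc]⟩

/-- Morphisms from covers lift along quasi-isomorphisms, up to refinement and homotopy. -/
lemma Map.exists_lift (hH : ∀ X Y : A, Subsingleton (Abelian.Ext X Y 2))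
    {C : Cover X} (φ : C.Map Z) :
    ∃ (C' : Cover X) (r : Hom C' C) (ψ : C'.Map Z'), Htpy (φ.refine r) (ψ.post s) := by
  obtain ⟨C₁, r₁, b₁, hb₁, y, e₁⟩ := exists_lift_cycle_cover s C φ.b φ.b_d
  obtain ⟨C₂, r₂, a₂, e₂⟩ := exists_lift_boundary_kernel s hH C₁ (C₁.i ≫ b₁) (by simp [hb₁])
    (r₁.k ≫ φ.a - C₁.i ≫ y) (by simp [e₁])
  obtain ⟨C₃, r₃, z, hz, t, e₃⟩ := exists_lift_cycle_kernel s hH C₂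
    (r₂.k ≫ (r₁.k ≫ φ.a - C₁.i ≫ y) - a₂ ≫ s.f ()) (by
      have := e₂ =≫ s.f ()
      simp only [Category.assoc, Hom.k_i_assoc] at this
      simp [← this, e₁])
  refine ⟨C₃, (r₃.comp r₂).comp r₁, ⟨r₃.r ≫ r₂.r ≫ b₁, r₃.k ≫ a₂ + z, by simp [hb₁], ?_⟩,
    r₃.r ≫ r₂.r ≫ y, t, ?_, ?_⟩
  · simp [hz, ← e₂]
  · simp [e₁]
  · simp only [Preadditive.comp_sub, Hom.k_i_assoc, sub_eq_iff_eq_add] at e₃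
    simp [e₃]
    abel

/-- Homotopies descend along quasi-isomorphisms, up to refinement. -/
lemma Map.exists_htpy_of_post (hH : ∀ X Y : A, Subsingleton (Abelian.Ext X Y 2))
    {C : Cover X} {φ φ' : C.Map Z'} (H : Htpy (φ.post s) (φ'.post s)) :
    ∃ (C' : Cover X) (r : Hom C' C), Htpy (φ.refine r) (φ'.refine r) := by
  obtain ⟨h, g, hb, ha⟩ := H
  simp only [Map.post_b, Map.post_a] at hb ha
  rw [← sub_eq_iff_eq_add', ← Preadditive.sub_comp] at hb
  rw [add_assoc, ← sub_eq_iff_eq_add', ← Preadditive.sub_comp] at ha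
  have hd : (φ.a - φ'.a) ≫ Z'.d () () = C.i ≫ (φ.b - φ'.b) := by simp
  obtain ⟨C₁, r₁, c, e₁⟩ := exists_lift_boundary_cover s C (φ.b - φ'.b) (by simp) h hb
  obtain ⟨C₂, r₂, z, hz, e, e₂⟩ := exists_lift_cycle_cover s C₁ (r₁.r ≫ h - c ≫ s.f ()) (by
    have := e₁ =≫ s.f ()
    simp only [Category.assoc, hb] at this
    simp [this])
  have e₂' : r₂.r ≫ c ≫ s.f () + z ≫ s.f () = r₂.r ≫ r₁.r ≫ h - e ≫ Z.d () () := by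
    rw [Preadditive.comp_sub, sub_eq_iff_eq_add] at e₂
    rw [e₂]; abel
  obtain ⟨C₃, r₃, g', e₃⟩ := exists_lift_boundary_kernel s hH C₂
    (r₂.k ≫ r₁.k ≫ (φ.a - φ'.a) - C₂.i ≫ (r₂.r ≫ c + z))
    (by
      simp only [Preadditive.sub_comp, Category.assoc, Preadditive.add_comp, hz, add_zero]
      rw [← Preadditive.sub_comp, hd, ← e₁]
      simp)
    (r₂.k ≫ r₁.k ≫ g + C₂.i ≫ e) (by
      rw [Preadditive.sub_comp, Category.assoc, Category.assoc, ha, Category.assoc,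
        Preadditive.add_comp, Category.assoc, e₂']
      simp)
  refine ⟨C₃, (r₃.comp r₂).comp r₁, r₃.r ≫ (r₂.r ≫ c + z), g', ?_, ?_⟩
  · rw [← sub_eq_iff_eq_add']
    simp [hz, ← e₁]
  · rw [add_assoc, ← sub_eq_iff_eq_add', ← e₃]
    simp

end QuasiIso

end Cover

end Covers

section Localization

universe t v₁ v₂ u₁ u₂

open Opposite

/-- A criterion for a functor to types to compute the morphisms from `L.obj X` in a
localized category. -/
lemma CategoryTheory.Localization.bijective_of_lift {C : Type u₁} [Category.{v₁} C]
    {D : Type u₂} [Category.{v₂} D]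
    (L : C ⥤ D) (W : MorphismProperty C) [L.IsLocalization W] (X : C) (F : C ⥤ Type t)
    (hF : W.IsInvertedBy F) (τ : ∀ Z, F.obj Z → (L.obj X ⟶ L.obj Z))
    (hτ : ∀ {Z Z' : C} (s : Z ⟶ Z') (y : F.obj Z), τ Z' (F.map s y) = τ Z y ≫ L.map s)
    (x₀ : F.obj X) (h₀ : τ X x₀ = 𝟙 _)
    (hfac : ∀ {Z : C} (y : F.obj Z), ∃ (K : C) (π : K ⟶ X) (g : K ⟶ Z) (x : F.obj K),
      W π ∧ F.map π x = x₀ ∧ F.map g x = y) (Z : C) :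
    Function.Bijective (τ Z) := by
  let F' := Localization.lift F hF L
  let e : L ⋙ F' ≅ F := Localization.fac F hF L
  have he {Z Z' : C} (s : Z ⟶ Z') (y : F.obj Z) :
      F'.map (L.map s) (e.inv.app Z y) = e.inv.app Z' (F.map s y) :=
    (ConcreteCategory.congr_hom (e.inv.naturality s) y).symm
  constructor
  · have key (y : F.obj Z) : F'.map (τ Z y) (e.inv.app X x₀) = e.inv.app Z y := by
      obtain ⟨K, π, g, x, hπ, hx, rfl⟩ := hfac y
      have : IsIso (L.map π) := Localization.inverts L W π hπ
      have h₁ : L.map π ≫ τ K x = 𝟙 _ := by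
        rw [← cancel_mono (L.map π), Category.assoc, ← hτ, hx, h₀, Category.comp_id,
          Category.id_comp]
      rw [hτ, Functor.map_comp, ConcreteCategory.comp_apply, ← hx, ← he,
        ← ConcreteCategory.comp_apply (F'.map (L.map π)), ← F'.map_comp, h₁, F'.map_id, ← he]
      rfl
    intro y y' h
    have h' : e.inv.app Z y = e.inv.app Z y' := by rw [← key, ← key, h]
    simpa using congrArg (e.hom.app Z) h'
  · intro f
    let α : F ⋙ uliftFunctor.{v₂} ⟶ L ⋙ coyoneda.obj (op (L.obj X)) ⋙ uliftFunctor.{t} :=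
      { app Z := ↾(fun y => ⟨τ Z y.down⟩)
        naturality Z Z' s := by
          ext y
          exact congrArg ULift.up (hτ s y.down) }
    let _ : Localization.Lifting L W F F' := ⟨e⟩
    let β := Localization.liftNatTrans L W _ _ (F' ⋙ uliftFunctor.{v₂})
      (coyoneda.obj (op (L.obj X)) ⋙ uliftFunctor.{t}) α
    have hβ (Z : C) (y : F.obj Z) : β.app (L.obj Z) ⟨e.inv.app Z y⟩ = ⟨τ Z y⟩ := by
      dsimp only [β]
      rw [Localization.liftNatTrans_app]
      have : e.hom.app Z (e.inv.app Z y) = y := by simp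
      exact congrArg ULift.up (congrArg (τ Z) this)
    refine ⟨e.hom.app Z (F'.map f (e.inv.app X x₀)), ?_⟩
    have h₁ := hβ Z (e.hom.app Z (F'.map f (e.inv.app X x₀)))
    have h₂ : e.inv.app Z (e.hom.app Z (F'.map f (e.inv.app X x₀))) =
      F'.map f (e.inv.app X x₀) := by simp
    rw [h₂] at h₁
    have h₃ := ConcreteCategory.congr_hom (β.naturality f) ⟨e.inv.app X x₀⟩
    have h₄ := (h₁.symm.trans h₃).trans (congrArg
      ((coyoneda.obj (op (L.obj X)) ⋙ uliftFunctor.{t}).map f) (hβ X x₀))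
    refine (congrArg ULift.down h₄).trans ?_
    change τ X x₀ ≫ f = f
    rw [h₀, Category.id_comp]

end Localization

section CoverComplex

variable {A : Type u} [Category.{v} A] [Abelian A] {X : A}

namespace Cover

/-- The `1`-periodic complex obtained by folding the resolution `K → E`. -/
def fold (C : Cover X) : OnePeriodic A where
  X _ := C.E ⊞ C.K
  d _ _ := biprod.snd ≫ C.i ≫ biprod.inl
  shape _ _ h := absurd trivial h
  d_comp_d' := by intros; simp

/-- The inclusion of the covering object. -/
def inl (C : Cover X) : C.E ⟶ C.fold.X () := biprod.inl

/-- The inclusion of the kernel. -/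
def inr (C : Cover X) : C.K ⟶ C.fold.X () := biprod.inr

/-- The projection onto the covering object. -/
def fst (C : Cover X) : C.fold.X () ⟶ C.E := biprod.fst

/-- The projection onto the kernel. -/
def snd (C : Cover X) : C.fold.X () ⟶ C.K := biprod.snd

/-- A morphism from the folding given by its components. -/
def desc (C : Cover X) {T : A} (b : C.E ⟶ T) (a : C.K ⟶ T) : C.fold.X () ⟶ T := biprod.desc b a

section

variable (C : Cover X) {T : A}

@[simp]
lemma inl_desc (b : C.E ⟶ T) (a : C.K ⟶ T) : C.inl ≫ C.desc b a = b := biprod.inl_desc _ _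

@[simp]
lemma inr_desc (b : C.E ⟶ T) (a : C.K ⟶ T) : C.inr ≫ C.desc b a = a := biprod.inr_desc _ _

@[simp]
lemma inl_desc_assoc {T' : A} (b : C.E ⟶ T) (a : C.K ⟶ T) (f : T ⟶ T') :
    C.inl ≫ C.desc b a ≫ f = b ≫ f := biprod.inl_desc_assoc _ _ _

@[simp]
lemma inr_desc_assoc {T' : A} (b : C.E ⟶ T) (a : C.K ⟶ T) (f : T ⟶ T') :
    C.inr ≫ C.desc b a ≫ f = a ≫ f := biprod.inr_desc_assoc _ _ _

lemma fold_d : C.fold.d () () = C.snd ≫ C.i ≫ C.inl := rfl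

@[simp]
lemma inl_fold_d : C.inl ≫ C.fold.d () () = 0 := biprod.inl_snd_assoc _ |>.trans zero_comp

@[simp]
lemma inr_fold_d : C.inr ≫ C.fold.d () () = C.i ≫ C.inl := biprod.inr_snd_assoc _

@[simp]
lemma inl_fold_d_assoc (f : C.fold.X () ⟶ T) : C.inl ≫ C.fold.d () () ≫ f = 0 := by
  rw [← Category.assoc, inl_fold_d, zero_comp]

@[simp]
lemma inr_fold_d_assoc (f : C.fold.X () ⟶ T) :
    C.inr ≫ C.fold.d () () ≫ f = C.i ≫ C.inl ≫ f := by
  rw [← Category.assoc, inr_fold_d, Category.assoc]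

@[simp]
lemma inl_fst : C.inl ≫ C.fst = 𝟙 _ := biprod.inl_fst

@[simp]
lemma inr_fst : C.inr ≫ C.fst = 0 := biprod.inr_fst

lemma total : C.fst ≫ C.inl + C.snd ≫ C.inr = 𝟙 _ := biprod.total

variable {C} in
lemma hom_ext {f g : C.fold.X () ⟶ T} (h₁ : C.inl ≫ f = C.inl ≫ g) (h₂ : C.inr ≫ f = C.inr ≫ g) :
    f = g := biprod.hom_ext' _ _ h₁ h₂

end

/-- The tautological morphism from a resolution to its folding. -/
@[simps]
def univ (C : Cover X) : C.Map C.fold where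
  b := C.inl
  a := C.inr
  b_d := by simp
  a_d := by simp

/-- The augmentation of a resolution. -/
@[simps]
def aug (C : Cover X) : C.Map (stalkC X) where
  b := C.p
  a := 0
  b_d := comp_zero
  a_d := zero_comp.trans (kernel.condition C.p).symm

lemma aug_refine {C C' : Cover X} (r : Hom C' C) : C.aug.refine r = C'.aug := by
  ext
  · exact r.w
  · exact comp_zero

namespace Map

variable {Z Z' : OnePeriodic A} {C C' : Cover X}

/-- The morphism of `1`-periodic complexes induced by a morphism from a resolution. -/
def toHom (φ : C.Map Z) : C.fold ⟶ Z where
  f _ := C.desc φ.b φ.a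
  comm' := by
    rintro ⟨⟩ ⟨⟩ -
    refine hom_ext ?_ ?_
    · rw [inl_desc_assoc, inl_fold_d_assoc, b_d]
    · rw [inr_desc_assoc, inr_fold_d_assoc, inl_desc, a_d]

@[simp]
lemma inl_toHom (φ : C.Map Z) : C.inl ≫ φ.toHom.f () = φ.b := inl_desc _ _ _

@[simp]
lemma inr_toHom (φ : C.Map Z) : C.inr ≫ φ.toHom.f () = φ.a := inr_desc _ _ _

@[simp]
lemma univ_post_toHom (φ : C.Map Z) : C.univ.post φ.toHom = φ := by
  ext <;> simp

lemma toHom_ext {f g : C.fold ⟶ Z} (h : C.univ.post f = C.univ.post g) : f = g := by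
  ext
  exact hom_ext (congrArg Map.b h) (congrArg Map.a h)

lemma post_comp {Z'' : OnePeriodic A} (φ : C.Map Z) (s : Z ⟶ Z') (t : Z' ⟶ Z'') :
    φ.post (s ≫ t) = (φ.post s).post t := by
  ext <;> simp

lemma toHom_post (φ : C.Map Z) (s : Z ⟶ Z') : (φ.post s).toHom = φ.toHom ≫ s :=
  toHom_ext (by rw [univ_post_toHom, post_comp, univ_post_toHom])

lemma toHom_refine (φ : C.Map Z) (r : Hom C' C) :
    (φ.refine r).toHom = (C.univ.refine r).toHom ≫ φ.toHom := by
  rw [← toHom_post, refine_post, univ_post_toHom]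

/-- Homotopic morphisms from a resolution induce homotopic morphisms of complexes. -/
lemma Htpy.nonempty_homotopy {φ φ' : C.Map Z} (H : Htpy φ φ') :
    Nonempty (Homotopy φ.toHom φ'.toHom) := by
  obtain ⟨h, g, hb, ha⟩ := H
  let t : ∀ i j, C.fold.X i ⟶ Z.X j := fun _ _ ↦ C.desc h g
  refine ⟨{ hom := t, zero := fun _ _ h ↦ absurd trivial h, comm := ?_ }⟩
  intro j
  rw [dNext_eq (i' := j) t trivial, prevD_eq (j' := j) t trivial]
  refine hom_ext ?_ ?_
  · change _ = C.inl ≫ (C.fold.d () () ≫ C.desc h g + C.desc h g ≫ Z.d () () + φ'.toHom.f ())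
    refine (φ.inl_toHom).trans ?_
    simp [hb, add_comm]
  · change _ = C.inr ≫ (C.fold.d () () ≫ C.desc h g + C.desc h g ≫ Z.d () () + φ'.toHom.f ())
    refine (φ.inr_toHom).trans ?_
    simp [ha]
    abel

end Map

lemma quasiIso_aug (C : Cover X) : HomologicalComplex.quasiIso A oneShape C.aug.toHom := by
  have hf : C.aug.toHom.f () = C.fst ≫ C.aug.b := by
    refine hom_ext ?_ ?_
    · rw [Map.inl_toHom, ← Category.assoc, inl_fst, Category.id_comp]
    · rw [Map.inr_toHom, ← Category.assoc, inr_fst, zero_comp, aug_a]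
  rw [HomologicalComplex.mem_quasiIso_iff, quasiIso_iff]
  rintro ⟨⟩
  rw [quasiIsoAt_iff_isIso_homologyMap]
  have h₁ : Mono (HomologicalComplex.homologyMap C.aug.toHom ()) := by
    rw [HomologicalComplex.mono_homologyMap_iff_up_to_refinements _ () () () rfl rfl]
    intro T x hx y hy
    have hx₁ : x ≫ C.snd = 0 := by
      have := hx =≫ C.fst
      rw [fold_d] at this
      rw [← cancel_mono C.i]
      simpa using this
    have hx₂ : (x ≫ C.fst) ≫ C.p = 0 := by
      have : x ≫ C.fst ≫ C.aug.b = 0 := by rw [← hf, hy]; exact comp_zero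
      exact (Category.assoc _ _ _).trans this
    refine ⟨T, 𝟙 _, inferInstance, kernel.lift _ _ hx₂ ≫ C.inr, ?_⟩
    have := x ≫= C.total
    rw [Preadditive.comp_add, ← Category.assoc x C.snd, hx₁, zero_comp, add_zero,
      Category.comp_id] at this
    simpa using this.symm
  have h₂ : Epi (HomologicalComplex.homologyMap C.aug.toHom ()) := by
    rw [HomologicalComplex.epi_homologyMap_iff_up_to_refinements _ () () () rfl rfl]
    intro T y _
    obtain ⟨T', π, hπ, z, hz⟩ := surjective_up_to_refinements_of_epi C.p y
    refine ⟨T', π, hπ, z ≫ C.inl, by simp, 0, ?_⟩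
    rw [hf, zero_comp, add_zero, Category.assoc, ← Category.assoc C.inl, inl_fst,
      Category.id_comp]
    exact hz
  exact isIso_of_mono_of_epi _

/-- Morphisms from arbitrary covers of `X` to `Z`. -/
abbrev Roof (X : A) (Z : OnePeriodic A) := Σ C : Cover X, C.Map Z

namespace Roof

variable {Z Z' : OnePeriodic A}

/-- Two morphisms from covers are equivalent if they become homotopic on a common refinement. -/
def Rel (a b : Roof X Z) : Prop :=
  ∃ (C : Cover X) (r : Hom C a.1) (r' : Hom C b.1), Map.Htpy (a.2.refine r) (b.2.refine r')

lemma rel_of_htpy {C : Cover X} {φ φ' : C.Map Z} (H : Map.Htpy φ φ') :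
    Rel ⟨C, φ⟩ ⟨C, φ'⟩ :=
  ⟨C, Hom.id C, Hom.id C, H.refine _⟩

lemma rel_refine {C C' : Cover X} (φ : C.Map Z) (r : Hom C' C) :
    Rel ⟨C', φ.refine r⟩ ⟨C, φ⟩ :=
  ⟨C', Hom.id C', (Hom.id C').comp r, by rw [Map.refine_refine]; exact .refl _⟩

lemma Rel.symm {a b : Roof X Z} (H : Rel a b) : Rel b a := by
  obtain ⟨C, r, r', h⟩ := H
  exact ⟨C, r', r, h.symm⟩

lemma Rel.trans {a b c : Roof X Z} (H : Rel a b) (H' : Rel b c) : Rel a c := by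
  obtain ⟨C, r, s, h⟩ := H
  obtain ⟨C', s', t, h'⟩ := H'
  obtain ⟨D, u, u', -⟩ := exists_common C C'
  refine ⟨D, u.comp r, u'.comp t, ?_⟩
  have h₁ := h.refine u
  have h₂ := h'.refine u'
  rw [Map.refine_refine, Map.refine_refine] at h₁ h₂
  exact (h₁.trans (Map.htpy_refine _ _ _)).trans h₂

/-- The equivalence relation on roofs. -/
def setoid (X : A) (Z : OnePeriodic A) : Setoid (Roof X Z) where
  r := Rel
  iseqv := ⟨fun _ ↦ rel_of_htpy (.refl _), Rel.symm, Rel.trans⟩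

/-- Composition of a roof with a morphism of complexes. -/
abbrev post (a : Roof X Z) (s : Z ⟶ Z') : Roof X Z' := ⟨a.1, a.2.post s⟩

lemma Rel.post {a b : Roof X Z} (H : Rel a b) (s : Z ⟶ Z') : Rel (a.post s) (b.post s) := by
  obtain ⟨C, r, r', h⟩ := H
  refine ⟨C, r, r', ?_⟩
  rw [← Map.refine_post, ← Map.refine_post]
  exact h.post s

lemma bijective_post [HasExt.{w} A] (hH : ∀ X Y : A, Subsingleton (Abelian.Ext X Y 2))
    (s : Z ⟶ Z') [QuasiIso s] :
    Function.Bijective (Quotient.map (sa := setoid X Z) (sb := setoid X Z')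
      (fun a ↦ a.post s) (fun _ _ H ↦ H.post s)) := by
  constructor
  · rintro ⟨a⟩ ⟨b⟩ h
    obtain ⟨C, r, r', H⟩ : Rel (a.post s) (b.post s) := Quotient.exact h
    rw [← Map.refine_post, ← Map.refine_post] at H
    obtain ⟨C', t, H'⟩ := Map.exists_htpy_of_post s hH H
    rw [Map.refine_refine, Map.refine_refine] at H'
    exact Quotient.sound (s := setoid X Z) ⟨C', _, _, H'⟩
  · rintro ⟨C, φ⟩
    obtain ⟨C', r, ψ, H⟩ := Map.exists_lift s hH φ
    exact ⟨Quotient.mk _ ⟨C', ψ⟩, Quotient.sound (s := setoid X Z')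
      ((rel_of_htpy H.symm).trans (rel_refine φ r))⟩

/-- The functor of equivalence classes of roofs. -/
def functor (X : A) : OnePeriodic A ⥤ Type (max u v) where
  obj Z := Quotient (setoid X Z)
  map s := ↾(Quotient.map (sa := setoid X _) (sb := setoid X _)
      (fun a ↦ a.post s) (fun _ _ H ↦ H.post s))
  map_id Z := by
    ext ⟨C, φ⟩
    refine congrArg (Quotient.mk (setoid X Z)) (congrArg (Sigma.mk C) ?_)
    ext <;> simp
  map_comp {Z Z' Z''} s t := by
    ext ⟨C, φ⟩
    exact congrArg (Quotient.mk (setoid X Z'')) (congrArg (Sigma.mk C) (φ.post_comp s t))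

lemma functor_inverts [HasExt.{w} A] (hH : ∀ X Y : A, Subsingleton (Abelian.Ext X Y 2)) (X : A) :
    (HomologicalComplex.quasiIso A oneShape).IsInvertedBy (functor X) := by
  intro Z Z' s hs
  rw [HomologicalComplex.mem_quasiIso_iff] at hs
  exact (isIso_iff_bijective _).2 (bijective_post hH s)

variable [MorphismProperty.HasLocalization.{w'} (HomologicalComplex.quasiIso A oneShape)]

instance (C : Cover X) : IsIso (QD.map C.aug.toHom) :=
  Localization.inverts QD (HomologicalComplex.quasiIso A oneShape) _ C.quasiIso_aug

/-- The morphism in the derived category defined by a roof. -/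
def toD (a : Roof X Z) : QD.obj (stalkC X) ⟶ QD.obj Z :=
  inv (QD.map a.1.aug.toHom) ≫ QD.map a.2.toHom

lemma QD_map_eq_of_htpy {C : Cover X} {φ φ' : C.Map Z} (H : Map.Htpy φ φ') :
    QD.map φ.toHom = QD.map φ'.toHom := by
  have : oneShape.QFactorsThroughHomotopy A :=
    ComplexShape.QFactorsThroughHomotopy_of_exists_prev oneShape (fun _ ↦ ⟨(), trivial⟩) A
  exact HomologicalComplexUpToQuasiIso.Q_map_eq_of_homotopy H.nonempty_homotopy.some

lemma toD_refine {C C' : Cover X} (φ : C.Map Z) (r : Hom C' C) :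
    toD ⟨C', φ.refine r⟩ = toD ⟨C, φ⟩ := by
  dsimp [toD]
  rw [IsIso.inv_comp_eq, Map.toHom_refine, ← aug_refine r, Map.toHom_refine C.aug, QD.map_comp,
    QD.map_comp, Category.assoc, IsIso.hom_inv_id_assoc]

lemma Rel.toD_eq {a b : Roof X Z} (H : Rel a b) : toD a = toD b := by
  obtain ⟨C, r, r', h⟩ := H
  rw [← toD_refine _ r, ← toD_refine _ r']
  dsimp [toD]
  rw [QD_map_eq_of_htpy h]

lemma toD_post (a : Roof X Z) (s : Z ⟶ Z') : toD (a.post s) = toD a ≫ QD.map s := by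
  simp [toD, Map.toHom_post]

/-- Equivalence classes of roofs compute the morphisms in the `1`-periodic derived category. -/
lemma bijective_toD [HasExt.{w} A] (hH : ∀ X Y : A, Subsingleton (Abelian.Ext X Y 2)) (X : A)
    (Z : OnePeriodic A) :
    Function.Bijective (Quotient.lift (s := setoid X Z) toD (fun _ _ H ↦ Rel.toD_eq H)) := by
  refine Localization.bijective_of_lift QD (HomologicalComplex.quasiIso A oneShape) (stalkC X)
    (functor X) (functor_inverts hH X)
    (fun Z ↦ Quotient.lift (s := setoid X Z) toD (fun _ _ H ↦ Rel.toD_eq H)) ?_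
    (Quotient.mk _ ⟨.refl X, (Cover.refl X).aug⟩) ?_ ?_ Z
  · rintro Z Z' s ⟨a⟩
    exact toD_post a s
  · simp [toD]
  · rintro Z ⟨C, φ⟩
    refine ⟨C.fold, C.aug.toHom, φ.toHom, Quotient.mk _ ⟨C, C.univ⟩, C.quasiIso_aug, ?_, ?_⟩
    · refine Quotient.sound (s := setoid X _) ?_
      change Rel ⟨C, C.univ.post C.aug.toHom⟩ _
      rw [Map.univ_post_toHom, ← aug_refine C.toRefl]
      exact rel_refine _ _
    · refine congrArg (Quotient.mk (setoid X Z)) (congrArg (Sigma.mk C) ?_)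
      exact Map.univ_post_toHom φ

end Roof

end Cover

end CoverComplex

section StalkTarget

variable {A : Type u} [Category.{v} A] [Abelian A] {X Y : A}

lemma comp_stalkC_d {T : A} (f : T ⟶ (stalkC X).X ()) : f ≫ (stalkC X).d () () = 0 :=
  comp_zero

/-- A morphism of stalk complexes is a quasi-isomorphism if and only if it is induced by an
isomorphism. -/
lemma quasiIso_stalkHom_iff (f : X ⟶ Y) :
    HomologicalComplex.quasiIso A oneShape (stalkHom f) ↔ IsIso f := by
  rw [HomologicalComplex.mem_quasiIso_iff]
  constructor
  · intro h
    have : Mono f := Preadditive.mono_of_cancel_zero _ (fun {T} x hx ↦ by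
      obtain ⟨T', π, hπ, x₁, e⟩ := (HomologicalComplex.mono_homologyMap_iff_up_to_refinements
        (stalkHom f) () () () rfl rfl).1 inferInstance x comp_zero (0 : T ⟶ Y)
          (hx.trans zero_comp.symm)
      rw [← cancel_epi π, comp_zero]
      exact e.trans comp_zero)
    have : Epi f := by
      rw [epi_iff_surjective_up_to_refinements]
      intro T y
      obtain ⟨T', π, hπ, x, hx, y₁, e⟩ := (HomologicalComplex.epi_homologyMap_iff_up_to_refinements
        (stalkHom f) () () () rfl rfl).1 inferInstance y comp_zero
      refine ⟨T', π, hπ, x, e.trans ?_⟩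
      exact (congrArg (x ≫ f + ·) comp_zero).trans (add_zero _)
    exact isIso_of_mono_of_epi f
  · intro h
    have : ∀ i, IsIso ((stalkHom f).f i) := fun _ ↦ h
    have : IsIso (stalkHom f) := HomologicalComplex.Hom.isIso_of_components _
    infer_instance

namespace Cover

namespace Map

variable {C C' : Cover X}

/-- The component on the covering object of a morphism to a stalk complex. -/
def sb (φ : C.Map (stalkC Y)) : C.E ⟶ Y := φ.b

/-- The component on the kernel of a morphism to a stalk complex. -/
def sa (φ : C.Map (stalkC Y)) : C.K ⟶ Y := φ.a

lemma i_sb (φ : C.Map (stalkC Y)) : C.i ≫ φ.sb = 0 := φ.a_d.symm.trans comp_zero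

/-- The morphism induced on zeroth cohomology. -/
def hom (φ : C.Map (stalkC Y)) : X ⟶ Y :=
  (kernel_shortExact C.p).exact.desc φ.sb φ.i_sb

@[simp]
lemma p_hom (φ : C.Map (stalkC Y)) : C.p ≫ φ.hom = φ.sb :=
  (kernel_shortExact C.p).exact.g_desc _ _

lemma hom_refine (φ : C.Map (stalkC Y)) (r : Hom C' C) : (φ.refine r).hom = φ.hom := by
  rw [← cancel_epi C'.p, p_hom, ← r.w, Category.assoc, p_hom]
  rfl

/-- On homology, a morphism to a stalk complex only depends on the component on the
covering object. -/
lemma homologyMap_toHom (φ : C.Map (stalkC Y)) :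
    HomologicalComplex.homologyMap φ.toHom () =
      HomologicalComplex.homologyMap (C.aug.toHom ≫ stalkHom φ.hom) () := by
  rw [← toHom_post, ← cancel_epi (C.fold.homologyπ ()), HomologicalComplex.homologyπ_naturality,
    HomologicalComplex.homologyπ_naturality]
  congr 1
  rw [← cancel_mono ((stalkC Y).iCycles ()), HomologicalComplex.cyclesMap_i,
    HomologicalComplex.cyclesMap_i]
  have h : C.fold.iCycles () ≫ C.snd = 0 := by
    have := C.fold.iCycles_d () () =≫ C.fst
    rw [fold_d] at this
    rw [← cancel_mono C.i]
    simpa using this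
  have h' := C.fold.iCycles () ≫= C.total
  rw [Preadditive.comp_add, ← Category.assoc _ C.snd, h, zero_comp, add_zero,
    Category.comp_id] at h'
  rw [← h', Category.assoc, Category.assoc, Category.assoc, Category.assoc, inl_toHom, inl_toHom]
  congr 2
  exact φ.p_hom.symm

lemma quasiIso_toHom_iff (φ : C.Map (stalkC Y)) :
    HomologicalComplex.quasiIso A oneShape φ.toHom ↔ IsIso φ.hom := by
  have hC := C.quasiIso_aug
  rw [HomologicalComplex.mem_quasiIso_iff] at hC
  rw [← quasiIso_stalkHom_iff, HomologicalComplex.mem_quasiIso_iff,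
    HomologicalComplex.mem_quasiIso_iff, ← quasiIso_iff_comp_left C.aug.toHom, quasiIso_iff,
    quasiIso_iff]
  refine forall_congr' fun _ ↦ ?_
  rw [quasiIsoAt_iff_isIso_homologyMap, quasiIsoAt_iff_isIso_homologyMap]
  exact iff_of_eq (congrArg _ φ.homologyMap_toHom)

variable [HasExt.{w} A]

/-- The first extension class defined by a morphism to a stalk complex. -/
def extCls (φ : C.Map (stalkC Y)) : Abelian.Ext X Y 1 :=
  (kernel_shortExact C.p).extClass.comp (Abelian.Ext.mk₀ φ.sa) (add_zero 1)

lemma extCls_refine (φ : C.Map (stalkC Y)) (r : Hom C' C) : (φ.refine r).extCls = φ.extCls := by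
  let f : ShortComplex.mk (kernel.ι C'.p) C'.p (kernel.condition C'.p) ⟶
      ShortComplex.mk (kernel.ι C.p) C.p (kernel.condition C.p) :=
    { τ₁ := r.k
      τ₂ := r.r
      τ₃ := 𝟙 X }
  have h := (kernel_shortExact C'.p).extClass_naturality (kernel_shortExact C.p) f
  rw [Abelian.Ext.mk₀_id_comp] at h
  change (kernel_shortExact C'.p).extClass.comp (Abelian.Ext.mk₀ (r.k ≫ φ.sa)) _ = _
  rw [extCls, ← h, ← Abelian.Ext.mk₀_comp_mk₀, ← Abelian.Ext.comp_assoc_of_third_deg_zero]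

lemma htpy_iff (φ φ' : C.Map (stalkC Y)) :
    Htpy φ φ' ↔ φ.hom = φ'.hom ∧ φ.extCls = φ'.extCls := by
  have h₁ : φ.hom = φ'.hom ↔ φ.sb = φ'.sb := by
    rw [← cancel_epi C.p, p_hom, p_hom]
  have h₂ : φ.extCls = φ'.extCls ↔ ∃ h : C.E ⟶ Y, φ.sa = φ'.sa + C.i ≫ h := by
    have : φ.extCls = φ'.extCls + (kernel_shortExact C.p).extClass.comp
        (Abelian.Ext.mk₀ (φ.sa - φ'.sa)) (add_zero 1) := by
      rw [extCls, extCls, ← Abelian.Ext.comp_add, ← Abelian.Ext.mk₀_add, add_sub_cancel]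
    rw [this, add_eq_left]
    constructor
    · intro h
      obtain ⟨g, hg⟩ := Abelian.Ext.contravariant_sequence_exact₁ (kernel_shortExact C.p) Y
        _ rfl h
      obtain ⟨g, rfl⟩ := (Abelian.Ext.mk₀_bijective _ _).2 g
      rw [Abelian.Ext.mk₀_comp_mk₀] at hg
      exact ⟨g, by rw [← sub_eq_iff_eq_add']; exact ((Abelian.Ext.mk₀_bijective _ _).1 hg).symm⟩
    · rintro ⟨h, e⟩
      rw [← sub_eq_iff_eq_add'] at e
      rw [e, ← Abelian.Ext.mk₀_comp_mk₀]
      exact (kernel_shortExact C.p).extClass_comp_assoc _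
  rw [h₁, h₂]
  constructor
  · rintro ⟨h, g, hb, ha⟩
    rw [comp_stalkC_d, add_zero] at hb ha
    exact ⟨hb, h, ha⟩
  · rintro ⟨hb, (h : C.E ⟶ (stalkC Y).X ()), ha⟩
    refine ⟨h, 0, ?_, ?_⟩
    · rw [comp_stalkC_d, add_zero]
      exact hb
    · rw [comp_stalkC_d, add_zero]
      exact ha

end Map

namespace Roof

variable [HasExt.{w} A]

/-- The invariants of a roof between stalk complexes. -/
def invariants (a : Roof X (stalkC Y)) : (X ⟶ Y) × Abelian.Ext X Y 1 := (a.2.hom, a.2.extCls)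

lemma rel_iff (a b : Roof X (stalkC Y)) : Rel a b ↔ invariants a = invariants b := by
  obtain ⟨C₁, φ₁⟩ := a
  obtain ⟨C₂, φ₂⟩ := b
  have key {C} (r : Hom C C₁) (r' : Hom C C₂) :
      Map.Htpy (φ₁.refine r) (φ₂.refine r') ↔ invariants ⟨C₁, φ₁⟩ = invariants ⟨C₂, φ₂⟩ := by
    rw [Map.htpy_iff, Map.hom_refine, Map.hom_refine, Map.extCls_refine, Map.extCls_refine, invariants, invariants,
      Prod.ext_iff]
  constructor
  · rintro ⟨C, r, r', h⟩
    exact (key r r').1 h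
  · intro h
    obtain ⟨C, r, r', -⟩ := exists_common C₁ C₂
    exact ⟨C, r, r', (key r r').2 h⟩

lemma invariants_surjective (X Y : A) :
    Function.Surjective (invariants : Roof X (stalkC Y) → (X ⟶ Y) × Abelian.Ext X Y 1) := by
  rintro ⟨β, e⟩
  obtain ⟨E, p, hp, h⟩ := e.exists_epi_mk₀_comp_eq_zero
  obtain ⟨a, ha⟩ := Abelian.Ext.contravariant_sequence_exact₃ (kernel_shortExact p) Y e h
    (add_zero 1)
  obtain ⟨a, rfl⟩ := (Abelian.Ext.mk₀_bijective _ _).2 a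
  let C : Cover X := ⟨E, p, hp⟩
  let φ : C.Map (stalkC Y) :=
    { b := p ≫ β
      a := a
      b_d := comp_zero
      a_d := comp_zero.trans ((kernel.condition_assoc p β).trans zero_comp).symm }
  have h₁ : φ.hom = β := by
    rw [← cancel_epi p]
    exact φ.p_hom
  have h₂ : φ.extCls = e := ha
  exact ⟨⟨C, φ⟩, Prod.ext h₁ h₂⟩

variable [MorphismProperty.HasLocalization.{w'} (HomologicalComplex.quasiIso A oneShape)]

lemma isIso_toD_iff (a : Roof X (stalkC Y)) : IsIso (toD a) ↔ IsIso (invariants a).1 := by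
  rw [toD, isIso_comp_left_iff, HomologicalComplexUpToQuasiIso.isIso_Q_map_iff_mem_quasiIso,
    Map.quasiIso_toHom_iff]
  rfl

/-- The morphisms between stalk complexes in the `1`-periodic derived category of a hereditary
category. -/
def homEquiv (hH : ∀ X Y : A, Subsingleton (Abelian.Ext X Y 2)) (X Y : A) :
    (QD.obj (stalkC X) ⟶ QD.obj (stalkC Y)) ≃ (X ⟶ Y) × Abelian.Ext X Y 1 :=
  (Equiv.ofBijective _ (bijective_toD hH X (stalkC Y))).symm.trans
    (Equiv.ofBijective
      (Quotient.lift (s := setoid X (stalkC Y)) invariants (fun a b h ↦ (rel_iff a b).1 h))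
      ⟨by
        rintro ⟨a⟩ ⟨b⟩ h
        exact Quotient.sound (s := setoid X (stalkC Y)) ((rel_iff a b).2 h),
      fun y ↦ by
        obtain ⟨a, rfl⟩ := invariants_surjective X Y y
        exact ⟨Quotient.mk _ a, rfl⟩⟩)

lemma isIso_iff_homEquiv (hH : ∀ X Y : A, Subsingleton (Abelian.Ext X Y 2))
    (f : QD.obj (stalkC X) ⟶ QD.obj (stalkC Y)) :
    IsIso f ↔ IsIso (homEquiv hH X Y f).1 := by
  obtain ⟨q, rfl⟩ := (Equiv.ofBijective _ (bijective_toD hH X (stalkC Y))).surjective f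
  rw [homEquiv, Equiv.trans_apply, Equiv.symm_apply_apply]
  obtain ⟨a, rfl⟩ := Quotient.exists_rep q
  exact isIso_toD_iff a

end Roof

end Cover

end StalkTarget

/-- Automorphisms are the invertible endomorphisms. -/
def CategoryTheory.Aut.equivSubtypeIsIso {C : Type u} [Category.{v} C] (X : C) :
    Aut X ≃ {f : X ⟶ X // IsIso f} where
  toFun e := ⟨e.hom, Iso.isIso_hom e⟩
  invFun f := @asIso _ _ _ _ f.1 f.2
  left_inv e := by ext; rfl
  right_inv f := rfl

/-- **Statement 4** (Lemma 3.1(2)): `|Aut_{D₁(A)}(A)| = |Aut_A(A)| ⬝ |Ext¹_A(A,A)|`. -/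
theorem aut_card_in_one_periodic_derived_category
    (k : Type) [Field k] [Fintype k]
    {A : Type u} [Category.{v} A] [Abelian A] [Linear k A] [EssentiallySmall.{v} A]
    [HasExt.{w} A] [∀ X Y : A, Finite (X ⟶ Y)]
    (hExtFin : ∀ X Y : A, Finite (Abelian.Ext X Y 1))
    (hHered : ∀ X Y : A, Subsingleton (Abelian.Ext X Y 2))
    [MorphismProperty.HasLocalization.{w'} (HomologicalComplex.quasiIso A oneShape)]
    (X : A) :
    autD1 X = autCard X * ext1Card X X := by
  rw [autD1, autCard, ext1Card, ← Nat.card_prod]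
  exact Nat.card_congr <| (Aut.equivSubtypeIsIso _).trans <|
    ((Cover.Roof.homEquiv hHered X X).subtypeEquiv
      (q := fun y ↦ IsIso y.1) (Cover.Roof.isIso_iff_homEquiv hHered)).trans <|
    Equiv.prodSubtypeFstEquivSubtypeProd.trans
      ((Aut.equivSubtypeIsIso X).symm.prodCongr (.refl _))

end
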